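/- Let n and B be powers of two with B < n, let σ be uniformly distributed over the odd residues modulo n, let b be uniformly distributed over Z_n, with σ and b independent, and fix f ≠ f' in Z_n. Then: (i) if n/B does not divide (f − f') mod n, the offset o_{f,σ,b}(f') is uniformly distributed on Z_n; (ii) if (f − f') ≡ 2t·(n/B) (mod n) for some integer t, then P(o_{f,σ,b}(f') = ℓ) = 0 for every ℓ whose representative lies in [−n/B, n/B]; (iii) if (f − f') ≡ (2t+1)·(n/B) (mod n) for some integer t, then P(o_{f,σ,b}(f') = ℓ) = 0 for every ℓ with representative in [−n/(2B), n/(2B)) and P(o_{f,σ,b}(f') = ℓ) = 2/n for every ℓ with representative in [−n/B, −n/(2B)) ∪ [n/(2B), n/B]. -/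

import Mathlib

open Finset

/-- The (integer) rounded bucket index `round((B/n)·π_{σ,b}(f))`, where
`π_{σ,b}(f) = σ(f-b) mod n`. -/
noncomputable def hround (n B : ℕ) (σ b f : ZMod n) : ℤ :=
  round ((B : ℝ) / (n : ℝ) * (((σ * (f - b)).val : ℕ) : ℝ))

/-- The offset `o_{f,σ,b}(f') = π_{σ,b}(f') - (n/B)·h_{σ,b}(f)  (mod n)`. -/
noncomputable def offset (n B : ℕ) (σ b f f' : ZMod n) : ZMod n :=
  σ * (f' - b) - ((n / B : ℕ) : ZMod n) * ((hround n B σ b f : ℤ) : ZMod n)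

/-- The representative of `ℓ ∈ Z_n` in `(-n/2, n/2]`. -/
def rep (n : ℕ) (ℓ : ZMod n) : ℤ :=
  if (ℓ.val : ℤ) ≤ (n : ℤ) / 2 then (ℓ.val : ℤ) else (ℓ.val : ℤ) - (n : ℤ)

/-- A flat filter with `B` buckets and sharpness `F`. -/
def IsFlatFilter (n B F : ℕ) (G : ZMod n → ℝ) : Prop :=
  (∀ f : ZMod n, G (-f) = G f) ∧
  (∀ f : ZMod n, 0 ≤ G f ∧ G f ≤ 1) ∧
  (∀ f : ZMod n, (|rep n f| : ℝ) ≤ (n : ℝ) / (2 * B) → 1 - (1 / 4 : ℝ) ^ (F - 1) ≤ G f) ∧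
  (∀ f : ZMod n, (n : ℝ) / B ≤ (|rep n f| : ℝ) →
    G f ≤ (1 / 4 : ℝ) ^ (F - 1) * ((n : ℝ) / (B * (|rep n f| : ℝ))) ^ (F - 1))

/-- Discrete Fourier transform on `Z_n`. -/
noncomputable def dftZ (n : ℕ) [NeZero n] (x : ZMod n → ℂ) : ZMod n → ℂ := fun f =>
  (1 / (Real.sqrt n) : ℂ) *
    ∑ j : ZMod n, x j * Complex.exp (2 * (Real.pi : ℂ) * Complex.I *
      ((j.val * f.val : ℕ) : ℂ) / (n : ℂ))

/-- The value `(m_r)_{h_r(f)}` of the `r`-th measurement vector at bucket `h_r(f)`: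
`∑_{f'} Ĝ_{o_{f,σ,b}(f')} x̂_{f'}`. -/
noncomputable def measAt (n B : ℕ) [NeZero n] (G : ZMod n → ℝ) (σ b f : ZMod n)
    (xhat : ZMod n → ℂ) : ℂ :=
  ∑ f' : ZMod n, (G (offset n B σ b f f') : ℂ) * xhat f'

/-- Uniform sample space of hashing pairs `(σ, b)` with `σ` odd. -/
def hashPairs (n : ℕ) [NeZero n] : Finset (ZMod n × ZMod n) :=
  (Finset.univ.filter fun σ : ZMod n => Odd σ.val) ×ˢ Finset.univ

/-- Signed remainder of `u` after rounding to a multiple of `n/B`. -/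
noncomputable def gmap (n B : ℕ) (u : ZMod n) : ZMod n :=
  u - ((n / B : ℕ) : ZMod n) * ((round ((B : ℝ) / (n : ℝ) * ((u.val : ℕ) : ℝ)) : ℤ) : ZMod n)

/-- Number of preimages of `y` under `gmap`. -/
noncomputable def Fib (n B : ℕ) [NeZero n] (y : ZMod n) : ℕ :=
  ∑ u : ZMod n, if gmap n B u = y then 1 else 0

/-- The odd residues. -/
def oddRes (n : ℕ) [NeZero n] : Finset (ZMod n) :=
  Finset.univ.filter fun σ : ZMod n => Odd σ.val

lemma odd_iff (n : ℕ) [NeZero n] (h2 : 2 ∣ n) (s : ZMod n) :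
    Odd s.val ↔ ZMod.castHom h2 (ZMod 2) s = 1 := by
  conv_rhs => rw [← ZMod.natCast_zmod_val s]
  rw [map_natCast, ZMod.natCast_eq_one_iff_odd]

lemma isUnit_of_odd (n : ℕ) [NeZero n] (ha : ∃ a, n = 2 ^ a) (s : ZMod n) (hs : Odd s.val) :
    IsUnit s := by
  obtain ⟨a, rfl⟩ := ha
  rw [← ZMod.natCast_zmod_val s, ZMod.isUnit_iff_coprime]
  exact (Nat.coprime_two_right.mpr hs).pow_right a

lemma offset_eq (n B : ℕ) (σ b f f' : ZMod n) :
    offset n B σ b f f' = gmap n B (σ * (f - b)) - σ * (f - f') := by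
  unfold offset gmap hround
  ring

lemma count_eq (n B : ℕ) [NeZero n] (ha : ∃ a, n = 2 ^ a) (f f' ℓ : ZMod n) :
    ((hashPairs n).filter (fun p => offset n B p.1 p.2 f f' = ℓ)).card =
      ∑ σ ∈ oddRes n, Fib n B (ℓ + σ * (f - f')) := by
  rw [Finset.card_filter, hashPairs, Finset.sum_product]
  refine Finset.sum_congr rfl fun σ hσ => ?_
  have hu : IsUnit σ := isUnit_of_odd n ha σ (by simpa [oddRes] using hσ)
  obtain ⟨w, rfl⟩ := hu
  unfold Fib
  refine Fintype.sum_equiv ((Equiv.subLeft f).trans (Units.mulLeft w)) _ _ fun b => ?_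
  simp only [offset_eq, Equiv.trans_apply, Equiv.subLeft_apply, Units.mulLeft_apply, sub_eq_iff_eq_add]

lemma fib_sum (n B : ℕ) [NeZero n] (y : ZMod n) :
    ∑ k : ZMod n, Fib n B (y + k * ((n / B : ℕ) : ZMod n)) = n := by
  unfold Fib
  rw [Finset.sum_comm]
  have h : ∀ u : ZMod n,
      (∑ k : ZMod n, if gmap n B u = y + k * ((n / B : ℕ) : ZMod n) then 1 else 0) =
      ∑ k : ZMod n, if u = y + k * ((n / B : ℕ) : ZMod n) then 1 else 0 := by
    intro u
    refine Fintype.sum_equiv (Equiv.addRight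
      ((round ((B : ℝ) / (n : ℝ) * ((u.val : ℕ) : ℝ)) : ℤ) : ZMod n)) _ _ fun k => ?_
    simp only [gmap, Equiv.coe_addRight, sub_eq_iff_eq_add]
    congr 1
    apply propext
    rw [show ∀ a b c d : ZMod n, a + (b + c) * d = a + b * d + d * c by intros; ring]
  rw [Finset.sum_congr rfl fun u _ => h u, Finset.sum_comm]
  simp [ZMod.card]

lemma gmap_bound (n B M : ℕ) [NeZero n] (hB : 0 < B) (hM : n = B * M) (u : ZMod n) :
    ∃ ρ : ℤ, gmap n B u = (ρ : ZMod n) ∧ -(M : ℤ) ≤ 2 * ρ ∧ 2 * ρ < M := by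
  have hn : 0 < n := Nat.pos_of_ne_zero (NeZero.ne n)
  have hM0 : 0 < M := by
    rcases Nat.eq_zero_or_pos M with h | h
    · subst h; omega
    · exact h
  have hq : n / B = M := by rw [hM]; exact Nat.mul_div_cancel_left M hB
  have hx : (B : ℝ) / (n : ℝ) * ((u.val : ℕ) : ℝ) = (u.val : ℝ) / M := by
    have : (B : ℝ) ≠ 0 := by positivity
    have : (M : ℝ) ≠ 0 := by positivity
    have : (n : ℝ) = B * M := by exact_mod_cast hM
    rw [this]; field_simp
  refine ⟨(u.val : ℤ) - M * round ((u.val : ℝ) / M), ?_, ?_, ?_⟩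
  · unfold gmap
    rw [hx, hq]; push_cast; rw [ZMod.natCast_zmod_val]
  all_goals
    have h1 := Int.floor_le ((u.val : ℝ) / M + 1 / 2)
    have h2 := Int.lt_floor_add_one ((u.val : ℝ) / M + 1 / 2)
    rw [← round_eq] at h1 h2
    have hMr : (0 : ℝ) < M := by exact_mod_cast hM0
    have e : (u.val : ℝ) / M * M = u.val := by field_simp
    have g1 := mul_le_mul_of_nonneg_right h1 hMr.le
    have g2 := mul_lt_mul_of_pos_right h2 hMr
    have : ((2 * ((u.val : ℤ) - M * round ((u.val : ℝ) / M)) : ℤ) : ℝ) =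
      2 * ((u.val : ℝ) - M * round ((u.val : ℝ) / M)) := by push_cast; ring
  · have h3 : ((-(M : ℤ) : ℤ) : ℝ) ≤ ((2 * ((u.val : ℤ) - M * round ((u.val : ℝ) / M)) : ℤ) : ℝ) := by
      rw [this]; push_cast; nlinarith
    exact_mod_cast h3
  · have h3 : ((2 * ((u.val : ℤ) - M * round ((u.val : ℝ) / M)) : ℤ) : ℝ) < ((M : ℤ) : ℝ) := by
      rw [this]; push_cast; nlinarith
    exact_mod_cast h3

lemma rep_cast (n : ℕ) [NeZero n] (ℓ : ZMod n) : ((rep n ℓ : ℤ) : ZMod n) = ℓ := by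
  unfold rep
  split_ifs <;> simp

/-- Key arithmetic: if `gmap u = ℓ + k*M` then the integer representatives differ by `M*K`
with `K` of the parity of `k`. -/
lemma key (n B M : ℕ) [NeZero n] (hB : 0 < B) (hB2 : 2 ∣ B) (hM : n = B * M) (u ℓ : ZMod n) (k : ℤ)
    (h : gmap n B u = ℓ + (k : ZMod n) * ((n / B : ℕ) : ZMod n)) :
    ∃ ρ q : ℤ, gmap n B u = (ρ : ZMod n) ∧ -(M : ℤ) ≤ 2 * ρ ∧ 2 * ρ < M ∧
      ρ - rep n ℓ = M * (k + 2 * q) := by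
  obtain ⟨ρ, h1, h2, h3⟩ := gmap_bound n B M hB hM u
  have hq : n / B = M := by rw [hM]; exact Nat.mul_div_cancel_left M hB
  obtain ⟨c, hc⟩ := hB2
  have : ((ρ - rep n ℓ - M * k : ℤ) : ZMod n) = 0 := by
    push_cast
    rw [rep_cast, ← h1, h, hq]; ring
  rw [ZMod.intCast_zmod_eq_zero_iff_dvd] at this
  obtain ⟨z, hz⟩ := this
  refine ⟨ρ, c * z, h1, h2, h3, ?_⟩
  have : (n : ℤ) = 2 * c * M := by rw [hM, hc]; push_cast; ring
  rw [this] at hz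
  linear_combination hz

lemma card_odd (n : ℕ) [NeZero n] (h2 : 2 ∣ n) : 2 * (oddRes n).card = n := by
  have hz : ∀ x : ZMod 2, x + 1 = 1 ↔ ¬ x = 1 := by decide
  have h : (oddRes n).card = (Finset.univ.filter fun σ : ZMod n => ¬ Odd σ.val).card := by
    unfold oddRes
    rw [Finset.card_filter, Finset.card_filter]
    refine (Fintype.sum_equiv (Equiv.addRight (1 : ZMod n)) _ _ fun k => ?_).symm
    simp only [Equiv.coe_addRight, odd_iff n h2, map_add, map_one, hz]
  have := Finset.card_filter_add_card_filter_not (s := (Finset.univ : Finset (ZMod n)))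
    (fun σ : ZMod n => Odd σ.val)
  rw [← h, Finset.card_univ, ZMod.card] at this
  unfold oddRes at *
  omega

lemma tau_exists (n e : ℕ) [NeZero n] (ha : ∃ a, n = 2 ^ a) (d : ZMod n)
    (hd : ¬ (2 ^ e ∣ d.val)) :
    ∃ τ : ZMod n, (2 * τ) * d = ((2 ^ e : ℕ) : ZMod n) := by
  obtain ⟨a, rfl⟩ := ha
  have h0 : d.val ≠ 0 := by intro h; rw [h] at hd; simp at hd
  obtain ⟨j, m, hm, hj⟩ := Nat.exists_eq_two_pow_mul_odd h0
  have hje : j < e := by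
    by_contra hcon
    exact hd (hj ▸ (pow_dvd_pow 2 (not_lt.mp hcon)).mul_right m)
  have hc : m.Coprime (2 ^ a) := (Nat.coprime_two_right.mpr hm).pow_right a
  have hinv := ZMod.coe_mul_inv_eq_one m hc
  obtain ⟨i, rfl⟩ := Nat.exists_eq_add_of_lt hje
  refine ⟨2 ^ i * (m : ZMod (2 ^ a))⁻¹, ?_⟩
  have hd' : d = 2 ^ j * (m : ZMod (2 ^ a)) := by
    conv_lhs => rw [← ZMod.natCast_zmod_val d, hj]
    push_cast; ring
  rw [hd']
  push_cast
  linear_combination (2 ^ (j + i + 1) : ZMod (2 ^ a)) * hinv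

lemma sum_case1 (n B : ℕ) [NeZero n] (h2 : 2 ∣ n) (d τ ℓ : ZMod n)
    (hτ : (2 * τ) * d = ((n / B : ℕ) : ZMod n)) :
    ∑ σ ∈ oddRes n, Fib n B (ℓ + σ * d) = (oddRes n).card := by
  have hn : 0 < n := Nat.pos_of_ne_zero (NeZero.ne n)
  have shift : ∀ k : ZMod n, ∑ σ ∈ oddRes n, Fib n B (ℓ + σ * d) =
      ∑ σ ∈ oddRes n, Fib n B (ℓ + σ * d + k * ((n / B : ℕ) : ZMod n)) := by
    intro k
    unfold oddRes
    rw [Finset.sum_filter, Finset.sum_filter]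
    symm
    refine Fintype.sum_equiv (Equiv.addRight (k * (2 * τ))) _ _ fun σ => ?_
    have h20 : ((2 : ZMod 2)) = 0 := by decide
    have e : ℓ + (σ + k * (2 * τ)) * d = ℓ + σ * d + k * ((n / B : ℕ) : ZMod n) := by
      rw [← hτ]; ring
    have ho : Odd σ.val ↔ Odd (σ + k * (2 * τ)).val := by
      simp only [odd_iff n h2, map_add, map_mul, map_ofNat, h20, zero_mul, mul_zero, add_zero]
    rw [Equiv.coe_addRight]
    simp only [e]
    exact if_congr ho rfl rfl
  have : ∑ k : ZMod n, ∑ σ ∈ oddRes n, Fib n B (ℓ + σ * d) = (oddRes n).card * n := by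
    rw [Finset.sum_congr rfl fun k _ => shift k, Finset.sum_comm,
      Finset.sum_congr rfl fun σ _ => fib_sum n B (ℓ + σ * d)]
    simp
  rw [Finset.sum_const, Finset.card_univ, ZMod.card, smul_eq_mul, mul_comm] at this
  exact Nat.eq_of_mul_eq_mul_right hn this

lemma fib_zero (n B : ℕ) [NeZero n] (y : ZMod n) (h : ∀ u, gmap n B u ≠ y) : Fib n B y = 0 := by
  unfold Fib
  exact Finset.sum_eq_zero fun u _ => if_neg (h u)

lemma mul_le_neg_self (P w : ℤ) (hP : 0 < P) (hw : w < 0) : P * w ≤ -P := by nlinarith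

lemma self_le_mul_pos (P w : ℤ) (hP : 0 < P) (hw : 0 < w) : P ≤ P * w := by nlinarith

/-- Distribution of the offset `o_{f,σ,b}(f')` under a uniformly random hashing pair
`(σ, b)` with `σ` odd: (i) uniform on `Z_n` when `n/B ∤ (f - f')`; (ii) supported away from
`[-n/B, n/B]` when `(f-f')/(n/B)` is even; (iii) uniform with mass `2/n` on
`[-n/B, -n/(2B)) ∪ [n/(2B), n/B]` and zero on `[-n/(2B), n/(2B))` when `(f-f')/(n/B)` is
odd. -/
theorem offset_distribution
    (n B : ℕ) [NeZero n] (ha : ∃ a, n = 2 ^ a) (hb : ∃ c, B = 2 ^ c) (hBn : B < n)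
    (f f' : ZMod n) (hff : f ≠ f') :
    (¬ ((n / B) ∣ (f - f').val) →
      ∀ ℓ : ZMod n,
        (((hashPairs n).filter (fun p => offset n B p.1 p.2 f f' = ℓ)).card : ℝ) /
          ((hashPairs n).card : ℝ) = 1 / n) ∧
    ((∃ t : ℤ, (f - f') = (2 * t) * ((n / B : ℕ) : ZMod n)) →
      ∀ ℓ : ZMod n, -(((n / B : ℕ) : ℤ)) ≤ rep n ℓ → rep n ℓ ≤ ((n / B : ℕ) : ℤ) →
        ((hashPairs n).filter (fun p => offset n B p.1 p.2 f f' = ℓ)).card = 0) ∧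
    ((∃ t : ℤ, (f - f') = (2 * t + 1) * ((n / B : ℕ) : ZMod n)) →
      (∀ ℓ : ZMod n,
          -(((n / (2 * B) : ℕ) : ℤ)) ≤ rep n ℓ → rep n ℓ < ((n / (2 * B) : ℕ) : ℤ) →
          ((hashPairs n).filter (fun p => offset n B p.1 p.2 f f' = ℓ)).card = 0) ∧
      (∀ ℓ : ZMod n,
          ((-(((n / B : ℕ) : ℤ)) ≤ rep n ℓ ∧ rep n ℓ < -(((n / (2 * B) : ℕ) : ℤ))) ∨
            (((n / (2 * B) : ℕ) : ℤ) ≤ rep n ℓ ∧ rep n ℓ ≤ ((n / B : ℕ) : ℤ))) →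
          (((hashPairs n).filter (fun p => offset n B p.1 p.2 f f' = ℓ)).card : ℝ) /
            ((hashPairs n).card : ℝ) = 2 / n)) := by
  have hcount := count_eq n B ha f f'
  have hn : 0 < n := Nat.pos_of_ne_zero (NeZero.ne n)
  obtain ⟨c, hc⟩ := hb
  obtain ⟨a, ha'⟩ := ha
  have hB : 0 < B := by rw [hc]; positivity
  have hca : c < a := by
    rw [hc, ha'] at hBn
    exact (Nat.pow_lt_pow_iff_right (by norm_num)).mp hBn
  obtain ⟨i, hi⟩ := Nat.exists_eq_add_of_lt hca
  have hM : n = B * 2 ^ (i + 1) := by rw [ha', hc, hi]; ring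
  have hq : n / B = 2 ^ (i + 1) := by rw [hM]; exact Nat.mul_div_cancel_left _ hB
  have hq2 : n / (2 * B) = 2 ^ i := by
    rw [hM, show B * 2 ^ (i + 1) = (2 * B) * 2 ^ i by ring]
    exact Nat.mul_div_cancel_left _ (by omega)
  have h2 : 2 ∣ n := by rw [hM, pow_succ]; exact ⟨B * 2 ^ i, by ring⟩
  have hcard := card_odd n h2
  have hHP : (hashPairs n).card = (oddRes n).card * n := by
    unfold hashPairs oddRes
    rw [Finset.card_product, Finset.card_univ, ZMod.card]
  have hOpos : 0 < (oddRes n).card := by omega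
  have hMpos : (0 : ℤ) < 2 ^ i := by positivity
  have hMM : ((2 ^ (i + 1) : ℕ) : ℤ) = 2 * 2 ^ i := by push_cast; ring
  have hd : f - f' ≠ 0 := sub_ne_zero.mpr hff
  have hB2 : ∀ t : ZMod n, f - f' = t * ((n / B : ℕ) : ZMod n) → 2 ∣ B := by
    intro t ht
    rcases Nat.eq_zero_or_pos c with h | h
    · exfalso
      apply hd
      rw [ht, hc, h]
      simp
    · rw [hc]; exact dvd_pow_self 2 (by omega)
  have hOdd : ∀ σ : ZMod n, ((σ.val : ℤ) : ZMod n) = σ := by intro σ; simp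
  refine ⟨fun h ℓ => ?_, ?_, ?_⟩
  · rw [hq] at h
    obtain ⟨τ, hτ⟩ := tau_exists n (i + 1) ⟨a, ha'⟩ (f - f') h
    rw [← hq] at hτ
    rw [hcount, sum_case1 n B h2 _ τ ℓ hτ, hHP]
    push_cast
    field_simp
  · rintro ⟨t, ht⟩ ℓ hl1 hl2
    rw [hcount]
    refine Finset.sum_eq_zero fun σ hσ => fib_zero _ _ _ fun u hu => ?_
    have hσ' : Odd σ.val := by simpa [oddRes] using hσ
    obtain ⟨ρ, q, r1, r2, r3, r4⟩ := key n B _ hB (hB2 _ ht) hM u ℓ (σ.val * (2 * t))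
      (by rw [hu, ht]; push_cast; rw [ZMod.natCast_zmod_val]; ring)
    rw [hq] at hl1 hl2
    rw [hMM] at *
    have e : ρ - rep n ℓ = 4 * 2 ^ i * (σ.val * t + q) := by rw [r4]; ring
    have hw : (σ.val * t + q : ℤ) = 0 := by
      by_contra hne
      rcases lt_or_gt_of_ne hne with h | h
      · have := mul_le_neg_self (2 ^ i) _ hMpos h
        linarith
      · have := self_le_mul_pos (2 ^ i) _ hMpos h
        linarith
    rw [hw, mul_zero, sub_eq_zero] at e
    rw [r1, e, rep_cast] at hu
    have h0 : σ * (f - f') = 0 := by simpa using hu.symm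
    exact hd ((isUnit_of_odd n ⟨a, ha'⟩ σ hσ').mul_right_eq_zero.mp h0)
  · rintro ⟨t, ht⟩
    have hBe := hB2 _ ht
    constructor
    · intro ℓ hl1 hl2
      rw [hcount]
      refine Finset.sum_eq_zero fun σ hσ => fib_zero _ _ _ fun u hu => ?_
      have hσ' : Odd σ.val := by simpa [oddRes] using hσ
      obtain ⟨ρ, q, r1, r2, r3, r4⟩ := key n B _ hB hBe hM u ℓ (σ.val * (2 * t + 1))
        (by rw [hu, ht]; push_cast; rw [ZMod.natCast_zmod_val]; ring)
      rw [hq2] at hl1 hl2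
      push_cast at hl1 hl2
      rw [hMM] at *
      obtain ⟨s, hs⟩ := hσ'
      have e : ρ - rep n ℓ = 2 * 2 ^ i * (2 * (s * (2 * t + 1) + t + q) + 1) := by
        rw [r4, hs]; push_cast; ring
      rcases lt_or_ge (s * (2 * t + 1) + t + q) 0 with h | h
      · have := mul_le_neg_self (2 ^ i) _ hMpos h
        linarith
      · have := mul_nonneg hMpos.le h
        linarith
    · intro ℓ hl
      have hw : IsUnit ((2 * t + 1 : ZMod n)) := by
        apply isUnit_of_odd n ⟨a, ha'⟩
        rw [odd_iff n h2]
        have h20 : ((2 : ZMod 2)) = 0 := by decide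
        rw [map_add, map_mul, map_ofNat, map_one, h20, zero_mul, zero_add]
      have key2 : ∑ σ ∈ oddRes n, Fib n B (ℓ + σ * (f - f')) = n := by
        refine Eq.trans ?_ (fib_sum n B ℓ)
        trans ∑ σ : ZMod n, Fib n B (ℓ + σ * (f - f'))
        · refine Finset.sum_subset (Finset.subset_univ _) fun σ _ hσ => ?_
          refine fib_zero _ _ _ fun u hu => ?_
          have hσ' : Even σ.val := by simpa [oddRes] using hσ
          obtain ⟨ρ, q, r1, r2, r3, r4⟩ := key n B _ hB hBe hM u ℓ (σ.val * (2 * t + 1))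
            (by rw [hu, ht]; push_cast; rw [ZMod.natCast_zmod_val]; ring)
          rw [hq2, hq] at hl
          rw [hMM] at *
          push_cast at hl
          obtain ⟨s, hs⟩ := hσ'
          have e : ρ - rep n ℓ = 4 * 2 ^ i * (s * (2 * t + 1) + q) := by
            rw [r4, hs]; push_cast; ring
          rcases lt_trichotomy (s * (2 * t + 1) + q) 0 with h | h | h
          · have := mul_le_neg_self (2 ^ i) _ hMpos h
            rcases hl with hl | hl <;> linarith
          · rw [h] at e
            rcases hl with hl | hl <;> linarith
          · have := self_le_mul_pos (2 ^ i) _ hMpos h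
            rcases hl with hl | hl <;> linarith
        · obtain ⟨w, hw⟩ := hw
          refine Fintype.sum_equiv (Units.mulRight w) _ _ fun σ => ?_
          rw [Units.mulRight_apply, hw, ht, mul_assoc]
      rw [hcount, key2, hHP]
      have : (n : ℝ) = 2 * (oddRes n).card := by exact_mod_cast hcard.symm
      have : (0 : ℝ) < (oddRes n).card := by exact_mod_cast hOpos
      push_cast
      rw [‹(n : ℝ) = _›]
      field_simp
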